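/- It is not possible to arrange 6 red points and 5 blue points in the plane (11 distinct points, red and blue sets disjoint) such that exactly 6 lines contain exactly 2 red and exactly 2 blue points, and exactly 3 lines contain exactly 2 red and exactly 1 blue point. -/

import Mathlib

open scoped Classical

noncomputable section

/-- A line in the plane: the affine span of two distinct points. -/
def IsLine (L : Set (ℝ × ℝ)) : Prop :=
  ∃ p q : ℝ × ℝ, p ≠ q ∧ L = (affineSpan ℝ ({p, q} : Set (ℝ × ℝ)) : Set (ℝ × ℝ))

/-- The points of the finite set `P` lying on `L`. -/
def ptsOn (P : Finset (ℝ × ℝ)) (L : Set (ℝ × ℝ)) : Finset (ℝ × ℝ) :=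
  P.filter (fun x => x ∈ L)

/-- A line determined by `P`: contains at least two points of `P`. -/
def DeterminedLine (P : Finset (ℝ × ℝ)) (L : Set (ℝ × ℝ)) : Prop :=
  IsLine L ∧ 2 ≤ (ptsOn P L).card

/-- A bichromatic line: determined by `R ∪ B`, with at least one red and one blue point. -/
def BichromaticLine (R B : Finset (ℝ × ℝ)) (L : Set (ℝ × ℝ)) : Prop :=
  DeterminedLine (R ∪ B) L ∧ (∃ p ∈ R, p ∈ L) ∧ (∃ p ∈ B, p ∈ L)

/-- The number of bichromatic lines determined by `R ∪ B`. -/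
def nBichromatic (R B : Finset (ℝ × ℝ)) : ℕ :=
  {L : Set (ℝ × ℝ) | BichromaticLine R B L}.ncard

/-- A near-pencil: some line contains all but exactly one of the points of `P`. -/
def NearPencil (P : Finset (ℝ × ℝ)) : Prop :=
  ∃ L : Set (ℝ × ℝ), IsLine L ∧ (ptsOn P L).card = P.card - 1

/-- Twice the signed area of the triangle `p q r`; it vanishes iff the points are collinear. -/
def area (p q r : ℝ × ℝ) : ℝ :=
  (q.1 - p.1) * (r.2 - p.2) - (q.2 - p.2) * (r.1 - p.1)

/-- If the cevians `a₀p`, `a₁q`, `a₂r` of a triangle pass through a common point,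
then the barycentric coordinates of `p`, `q`, `r` satisfy Ceva's product formula. -/
theorem area_mul_eq_of_concurrent {a₀ a₁ a₂ b p q r : ℝ × ℝ} (hT : area a₀ a₁ a₂ ≠ 0)
    (hp : area b a₀ p = 0) (hq : area b a₁ q = 0) (hr : area b a₂ r = 0)
    (hzp : area a₀ a₁ p ≠ 0) (hxq : area q a₁ a₂ ≠ 0)
    (hxr : area r a₁ a₂ ≠ 0) (hyr : area a₀ r a₂ ≠ 0) :
    area a₀ a₁ p * area q a₁ a₂ * area a₀ r a₂ =
      area a₀ p a₂ * area a₀ a₁ q * area r a₁ a₂ := by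
  have e₀ : area a₀ b a₂ * area a₀ a₁ p = area a₀ a₁ b * area a₀ p a₂ := by
    have : area a₀ b a₂ * area a₀ a₁ p - area a₀ a₁ b * area a₀ p a₂
        = - area a₀ a₁ a₂ * area b a₀ p := by unfold area; ring
    rw [hp] at this; linarith
  have e₁ : area a₀ a₁ b * area q a₁ a₂ = area b a₁ a₂ * area a₀ a₁ q := by
    have : area a₀ a₁ b * area q a₁ a₂ - area b a₁ a₂ * area a₀ a₁ q
        = - area a₀ a₁ a₂ * area b a₁ q := by unfold area; ring
    rw [hq] at this; linarith
  have e₂ : area b a₁ a₂ * area a₀ r a₂ = area a₀ b a₂ * area r a₁ a₂ := by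
    have : area b a₁ a₂ * area a₀ r a₂ - area a₀ b a₂ * area r a₁ a₂
        = - area a₀ a₁ a₂ * area b a₂ r := by unfold area; ring
    rw [hr] at this; linarith
  have hsum : area b a₁ a₂ + area a₀ b a₂ + area a₀ a₁ b = area a₀ a₁ a₂ := by
    unfold area; ring
  generalize area b a₁ a₂ = u at *
  generalize area a₀ b a₂ = v at *
  generalize area a₀ a₁ b = w at *
  have hu : u ≠ 0 := by
    rintro rfl
    have hv : v = 0 := by simpa [hxr] using e₂.symm
    have hw : w = 0 := by simpa [hxq] using e₁
    exact hT (by rw [← hsum, hv, hw]; ring)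
  have hv : v ≠ 0 := by
    rintro rfl
    exact hu (by simpa [hyr] using e₂)
  have hw : w ≠ 0 := by
    rintro rfl
    exact hv (by simpa [hzp] using e₀)
  apply mul_left_cancel₀ (mul_ne_zero (mul_ne_zero hu hv) hw)
  calc u * v * w * (area a₀ a₁ p * area q a₁ a₂ * area a₀ r a₂)
      = (v * area a₀ a₁ p) * (w * area q a₁ a₂) * (u * area a₀ r a₂) := by ring
    _ = _ := by rw [e₀, e₁, e₂]; ring

/-- `a` and `c` are perspective from some point, with `a i` corresponding to `c (σ i)`. -/
def Perspective (a c : Fin 3 → ℝ × ℝ) (σ : Equiv.Perm (Fin 3)) : Prop :=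
  ∃ b, ∀ i, area b (a i) (c (σ i)) = 0

/-- No vertex of `c` lies on a line joining two vertices of `a`. -/
def OffSides (a c : Fin 3 → ℝ × ℝ) : Prop :=
  ∀ i j k, i ≠ j → area (a i) (a j) (c k) ≠ 0

theorem area_rotate (p q r : ℝ × ℝ) : area q r p = area p q r := by unfold area; ring

theorem area_swap (p q r : ℝ × ℝ) : area q p r = -area p q r := by unfold area; ring

/-- In the real plane a triangle cannot be perspective to another triple of points in
five different ways. -/
theorem false_of_perspective_of_area_ne_zero {a c : Fin 3 → ℝ × ℝ}
    (hT : area (a 0) (a 1) (a 2) ≠ 0) (hac : OffSides a c) (hca : OffSides c a)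
    (h : ∀ σ : Equiv.Perm (Fin 3), σ ≠ 1 → Perspective a c σ) : False := by
  have hx : ∀ k, area (c k) (a 1) (a 2) ≠ 0 := fun k => by
    rw [← area_rotate]; exact hac 1 2 k (by decide)
  have hy : ∀ k, area (a 0) (c k) (a 2) ≠ 0 := fun k => by
    rw [area_rotate (a 2)]; exact hac 2 0 k (by decide)
  have hz : ∀ k, area (a 0) (a 1) (c k) ≠ 0 := fun k => hac 0 1 k (by decide)
  have key : ∀ σ : Equiv.Perm (Fin 3), σ ≠ 1 →
      area (a 0) (a 1) (c (σ 0)) * area (c (σ 1)) (a 1) (a 2) * area (a 0) (c (σ 2)) (a 2) =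
      area (a 0) (c (σ 0)) (a 2) * area (a 0) (a 1) (c (σ 1)) * area (c (σ 2)) (a 1) (a 2) := by
    intro σ hσ
    obtain ⟨b, hb⟩ := h σ hσ
    exact area_mul_eq_of_concurrent hT (hb 0) (hb 1) (hb 2) (hz _) (hx _)
      (hx _) (hy _)
  have hD : area (a 0) (c 1) (a 2) * area (a 0) (a 1) (c 2)
      - area (a 0) (c 2) (a 2) * area (a 0) (a 1) (c 1)
      = area (a 0) (a 1) (a 2) * area (c 1) (c 2) (a 0) := by unfold area; ring
  have hne := mul_ne_zero hT (hca 1 2 0 (by decide))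
  rw [← hD] at hne
  have s₁ := key (finRotate 3) (by decide)
  have s₂ := key (finRotate 3)⁻¹ (by decide)
  have s₃ := key (Equiv.swap 0 1) (by decide)
  have s₄ := key (Equiv.swap 0 2) (by decide)
  rw [show finRotate 3 0 = 1 by decide, show finRotate 3 1 = 2 by decide,
    show finRotate 3 2 = 0 by decide] at s₁
  rw [show (finRotate 3)⁻¹ 0 = 2 by decide, show (finRotate 3)⁻¹ 1 = 0 by decide,
    show (finRotate 3)⁻¹ 2 = 1 by decide] at s₂
  rw [show Equiv.swap (0 : Fin 3) 1 0 = 1 by decide, show Equiv.swap (0 : Fin 3) 1 1 = 0 by decide,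
    show Equiv.swap (0 : Fin 3) 1 2 = 2 by decide] at s₃
  rw [show Equiv.swap (0 : Fin 3) 2 0 = 2 by decide, show Equiv.swap (0 : Fin 3) 2 1 = 1 by decide,
    show Equiv.swap (0 : Fin 3) 2 2 = 0 by decide] at s₄
  have hx0 := hx 0
  clear hD key h hac hca hT hx hy hz
  generalize area (c 0) (a 1) (a 2) = x₀ at *
  generalize area (c 1) (a 1) (a 2) = x₁ at *
  generalize area (c 2) (a 1) (a 2) = x₂ at *
  generalize area (a 0) (c 0) (a 2) = y₀ at *
  generalize area (a 0) (c 1) (a 2) = y₁ at *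
  generalize area (a 0) (c 2) (a 2) = y₂ at *
  generalize area (a 0) (a 1) (c 0) = z₀ at *
  generalize area (a 0) (a 1) (c 1) = z₁ at *
  generalize area (a 0) (a 1) (c 2) = z₂ at *
  have hcube : (x₀ * y₁ * z₂) ^ 3 = (x₀ * y₂ * z₁) ^ 3 := by
    have h₁ : (x₀ * y₁ * z₂) ^ 3 = (x₀ * y₁ * z₂) * (x₁ * y₂ * z₀) * (x₂ * y₀ * z₁) := by
      grind
    have h₂ : (x₀ * y₂ * z₁) ^ 3 = (x₀ * y₂ * z₁) * (x₁ * y₀ * z₂) * (x₂ * y₁ * z₀) := by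
      grind
    rw [h₁, h₂]; ring
  have heq : x₀ * y₁ * z₂ = x₀ * y₂ * z₁ := (Odd.strictMono_pow (by decide)).injective hcube
  apply hne
  apply mul_left_cancel₀ hx0
  linear_combination heq

/-- Two collinear triples in the real plane cannot be perspective in five different ways. -/
theorem false_of_perspective_of_area_eq_zero {a c : Fin 3 → ℝ × ℝ}
    (ha : area (a 0) (a 1) (a 2) = 0) (hc : area (c 0) (c 1) (c 2) = 0)
    (hac : OffSides a c) (hca : OffSides c a)
    (h : ∀ σ : Equiv.Perm (Fin 3), σ ≠ 1 → Perspective a c σ) : False := by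
  obtain ⟨b, hb⟩ := h (finRotate 3) (by decide)
  obtain ⟨b', hb'⟩ := h (finRotate 3)⁻¹ (by decide)
  have hf : ∀ i, area (c 0) (c 1) (a i) ≠ 0 := fun i => hca 0 1 i (by decide)
  have hg : ∀ j, area (a 0) (a 1) (c j) ≠ 0 := fun j => hac 0 1 j (by decide)
  have hgb : ∀ b j k, area b (a 0) (c j) = 0 → area b (a 1) (c k) = 0 →
      area (a 0) (a 1) b ≠ 0 := by
    intro b j k hj hk h0
    have e₁ : (b.1 - (a 0).1) * area (a 0) (a 1) (c j) = 0 := by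
      unfold area at *
      linear_combination ((c j).1 - (a 0).1) * h0 - ((a 1).1 - (a 0).1) * hj
    have e₂ : (b.2 - (a 0).2) * area (a 0) (a 1) (c j) = 0 := by
      unfold area at *
      linear_combination ((c j).2 - (a 0).2) * h0 - ((a 1).2 - (a 0).2) * hj
    have hb0 : b = a 0 := Prod.ext (by simpa [hg j, sub_eq_zero] using e₁)
      (by simpa [hg j, sub_eq_zero] using e₂)
    exact hg k (hb0 ▸ hk)
  -- In the coordinates `α`, `γ`, which send the common point of the two lines to infinity,
  -- perspectivities are affine.
  obtain ⟨α, hα⟩ : ∃ α : Fin 3 → ℝ, ∀ i, α i =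
    area (a 0) (c 0) (a i) / area (c 0) (c 1) (a i) := ⟨_, fun _ => rfl⟩
  obtain ⟨γ, hγ⟩ : ∃ γ : Fin 3 → ℝ, ∀ j, γ j =
    area (a 0) (c 0) (c j) / area (a 0) (a 1) (c j) := ⟨_, fun _ => rfl⟩
  have hga : ∀ i, area (a 0) (a 1) (a i) = 0 := by
    intro i; fin_cases i
    · simp [area]
    · simp [area]; ring
    · exact ha
  have hfc : ∀ i, area (c 0) (c 1) (c i) = 0 := by
    intro i; fin_cases i
    · simp [area]
    · simp [area]; ring
    · exact hc
  have affine : ∀ b, area (a 0) (a 1) b ≠ 0 → ∃ k l : ℝ, ∀ i j, area b (a i) (c j) = 0 →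
      γ j = k * α i + l := by
    intro b hgb
    refine ⟨-(area (c 0) (c 1) b / area (a 0) (a 1) b),
      area (a 0) (c 0) b / area (a 0) (a 1) b, fun i j hij => ?_⟩
    have hdet : area (c 0) (c 1) (a i) * (area (a 0) (a 1) b * area (a 0) (c 0) (c j)
          - area (a 0) (c 0) b * area (a 0) (a 1) (c j))
        + area (a 0) (c 0) (a i) * (area (c 0) (c 1) b * area (a 0) (a 1) (c j)) = 0 := by
      have : ∀ p q r s u v w : ℝ × ℝ,
        area r s u * (area p q v * area p r w - area p r v * area p q w)
        - area p q u * (area r s v * area p r w - area p r v * area r s w)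
        + area p r u * (area r s v * area p q w - area p q v * area r s w)
        = area p q r * area p r s * area u v w := by
        intros; unfold area; ring
      have := this (a 0) (a 1) (c 0) (c 1) (a i) b (c j)
      rw [hga, hfc, area_swap b, hij] at this
      linarith
    have h₁ := hf i
    have h₂ := hg j
    rw [hα, hγ]
    field_simp
    linear_combination hdet
  have hα0 : α 0 = 0 := by rw [hα]; simp [area]
  have hγ0 : γ 0 = 0 := by rw [hγ]; simp [area]; left; ring
  have hα1 : α 1 ≠ 0 := by
    rw [hα]
    refine div_ne_zero ?_ (hf _)
    rw [area_rotate (a 1)]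
    exact fun h0 => hac 0 1 0 (by decide) (by rw [area_swap, h0, neg_zero])
  have hγ2 : γ 2 ≠ 0 := by
    rw [hγ]
    refine div_ne_zero ?_ (hg _)
    rw [← area_rotate]
    exact hca 0 2 0 (by decide)
  obtain ⟨k, l, hkl⟩ := affine b (hgb b _ _ (hb 0) (hb 1))
  obtain ⟨k', l', hkl'⟩ := affine b' (hgb b' _ _ (hb' 0) (hb' 1))
  have t₁ : γ 1 = k * α 0 + l := hkl 0 1 (hb 0)
  have t₂ : γ 2 = k * α 1 + l := hkl 1 2 (hb 1)
  have t₃ : γ 0 = k * α 2 + l := hkl 2 0 (hb 2)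
  have t₄ : γ 2 = k' * α 0 + l' := hkl' 0 2 (hb' 0)
  have t₅ : γ 0 = k' * α 1 + l' := hkl' 1 0 (hb' 1)
  have t₆ : γ 1 = k' * α 2 + l' := hkl' 2 1 (hb' 2)
  rw [hα0, hγ0] at *
  have hq : k' * (α 1 ^ 2 - α 1 * α 2 + α 2 ^ 2) = 0 := by grind
  have hpos : 0 < α 1 ^ 2 - α 1 * α 2 + α 2 ^ 2 := by
    have : 0 < α 1 ^ 2 := by positivity
    nlinarith [sq_nonneg (α 1 - 2 * α 2)]
  have hk' : k' = 0 := by simpa [hpos.ne'] using hq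
  apply hγ2
  rw [hk'] at t₄ t₅
  linarith

theorem Perspective.symm {a c : Fin 3 → ℝ × ℝ} {σ : Equiv.Perm (Fin 3)}
    (h : Perspective a c σ) : Perspective c a σ⁻¹ := by
  obtain ⟨b, hb⟩ := h
  refine ⟨b, fun i => ?_⟩
  have := hb (σ⁻¹ i)
  rw [show σ (σ⁻¹ i) = i from σ.apply_symm_apply i] at this
  rw [← area_rotate, area_swap, area_rotate b, this, neg_zero]

/-- Two triples of points in the real plane cannot be perspective in five different ways. -/
theorem false_of_perspective {a c : Fin 3 → ℝ × ℝ} (hac : OffSides a c) (hca : OffSides c a)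
    (h : ∀ σ : Equiv.Perm (Fin 3), σ ≠ 1 → Perspective a c σ) : False := by
  by_cases ha : area (a 0) (a 1) (a 2) = 0
  · by_cases hc : area (c 0) (c 1) (c 2) = 0
    · exact false_of_perspective_of_area_eq_zero ha hc hac hca h
    · refine false_of_perspective_of_area_ne_zero hc hca hac fun σ hσ => ?_
      simpa using (h σ⁻¹ (by simpa using hσ)).symm
  · exact false_of_perspective_of_area_ne_zero ha hac hca h

open Finset in
/-- Five perfect matchings `p b` of six points, any two sharing at most one edge, such that every
edge lies in at most two of them and there are at most nine edges: they are five of the six perfect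
matchings of a complete bipartite graph `K₃,₃`. -/
theorem exists_bipartition {ρ β : Type*} [Fintype ρ] [Fintype β] [DecidableEq ρ]
    (hρ : Fintype.card ρ = 6) (hβ : Fintype.card β = 5) (p : β → ρ → ρ)
    (hinv : ∀ b r, p b (p b r) = r) (hfix : ∀ b r, p b r ≠ r)
    (hedge : ∀ r r', (univ.filter fun b => p b r = r').card ≤ 2)
    (hshare : ∀ b b' r s, p b r = p b' r → p b s = p b' s → s ≠ r → s ≠ p b r → b = b')
    (hcount : (univ.filter fun e : ρ × ρ => ∃ b, p b e.1 = e.2).card ≤ 18) :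
    ∃ a c : Fin 3 → ρ, Function.Injective a ∧ Function.Injective c ∧ (∀ i j, a i ≠ c j) ∧
      ∀ σ : Equiv.Perm (Fin 3), σ ≠ 1 → ∃ b, ∀ i, p b (a i) = c (σ i) := by
  let N : ρ → Finset ρ := fun r => univ.image fun b => p b r
  have hmem : ∀ b r, p b r ∈ N r := fun b r => mem_image_of_mem _ (mem_univ b)
  have hN : ∀ {r s}, s ∈ N r ↔ ∃ b, p b r = s := by intro r s; simp [N]
  have hsymm : ∀ {r s}, s ∈ N r → r ∈ N s := by
    intro r s h
    obtain ⟨b, rfl⟩ := hN.1 h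
    exact hN.2 ⟨b, hinv b r⟩
  have hirr : ∀ r, r ∉ N r := fun r h => by
    obtain ⟨b, hb⟩ := hN.1 h
    exact hfix b r hb
  have hfib : ∀ r, ∑ s ∈ N r, (univ.filter fun b => p b r = s).card = 5 := fun r => by
    rw [← hβ, ← card_univ]
    exact (card_eq_sum_card_fiberwise fun b _ => hmem b r).symm
  have hge : ∀ r, 3 ≤ (N r).card := fun r => by
    have : ∑ s ∈ N r, (univ.filter fun b => p b r = s).card ≤ (N r).card * 2 :=
      sum_le_card_nsmul _ _ _ fun s _ => hedge r s
    rw [hfib] at this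
    omega
  have hdeg : ∀ r, (N r).card = 3 := by
    have hsum : ∑ r, (N r).card ≤ ∑ _r : ρ, 3 := by
      have : (univ.filter fun e : ρ × ρ => ∃ b, p b e.1 = e.2)
          = (univ.sigma N).map (Equiv.sigmaEquivProd ρ ρ).toEmbedding := by
        ext ⟨r, s⟩
        simp [N]
      rw [this, card_map, card_sigma] at hcount
      simpa [hρ] using hcount
    have heq := (sum_eq_sum_iff_of_le fun r _ => hge r).1
      (le_antisymm (sum_le_sum fun r _ => hge r) hsum)
    exact fun r => (heq r (mem_univ r)).symm
  have hone : ∀ r x y, y ∈ N r → y ∈ N x → x ∈ N r →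
      (univ.filter fun b => p b r = x).card ≤ 1 := by
    intro r x y hyr hyx hxr
    have hry : r ≠ y := fun h => hirr r (h ▸ hyr)
    have hxy : x ≠ y := fun h => hirr x (h ▸ hyx)
    have hrx : r ≠ x := fun h => hirr r (h ▸ hxr)
    have hcard : (((N y).erase r).erase x).card = 1 := by
      rw [card_erase_of_mem (mem_erase.2 ⟨hrx.symm, hsymm hyx⟩), card_erase_of_mem (hsymm hyr),
        hdeg]
    obtain ⟨w, hw⟩ := card_eq_one.1 hcard
    have hforce : ∀ b, p b r = x → p b y = w := by
      intro b hb
      have : p b y ∈ ((N y).erase r).erase x := by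
        refine mem_erase.2 ⟨fun h => ?_, mem_erase.2 ⟨fun h => ?_, hmem b y⟩⟩
        · exact hry ((hinv b r).symm.trans (by rw [hb, ← h, hinv]))
        · exact hxy (by rw [← hb, ← h, hinv])
      rw [hw] at this
      exact mem_singleton.1 this
    refine card_le_one.2 fun b hb b' hb' => ?_
    simp only [mem_filter, mem_univ, true_and] at hb hb'
    exact hshare b b' r y (hb.trans hb'.symm) ((hforce b hb).trans (hforce b' hb').symm)
      hry.symm (hb ▸ hxy.symm)
  have htri : ∀ r x y, x ∈ N r → y ∈ N r → y ∉ N x := by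
    intro r x y hx hy hyx
    have hxy : y ≠ x := fun h => hirr x (h ▸ hyx)
    have h₁ := hone r x y hy hyx hx
    have h₂ := hone r y x hx (hsymm hyx) hy
    have h₅ := hfib r
    rw [← add_sum_erase _ _ hx, ← add_sum_erase _ _ (mem_erase.2 ⟨hxy, hy⟩)] at h₅
    have h₃ : ∑ s ∈ ((N r).erase x).erase y, (univ.filter fun b => p b r = s).card ≤
        (((N r).erase x).erase y).card * 2 := sum_le_card_nsmul _ _ _ fun s _ => hedge r s
    rw [card_erase_of_mem (mem_erase.2 ⟨hxy, hy⟩), card_erase_of_mem hx, hdeg] at h₃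
    omega
  obtain ⟨r⟩ : Nonempty ρ := Fintype.card_pos_iff.1 (by omega)
  have hA : (N r)ᶜ.card = 3 := by rw [card_compl, hρ, hdeg]
  have hNc : ∀ c ∈ N r, N c = (N r)ᶜ := fun c hc =>
    eq_of_subset_of_card_le (fun x hx => mem_compl.2 fun hxr => htri r c x hc hxr hx)
      (by rw [hA, hdeg])
  have hNa : ∀ a ∉ N r, N a = N r := fun a ha =>
    (eq_of_subset_of_card_le (fun c hc => hsymm (by rw [hNc c hc]; exact mem_compl.2 ha))
      (by rw [hdeg, hdeg])).symm
  let a : Fin 3 ≃ ((N r)ᶜ : Finset ρ) := (equivFinOfCardEq hA).symm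
  let c : Fin 3 ≃ N r := (equivFinOfCardEq (hdeg r)).symm
  have ha : ∀ i, (a i : ρ) ∉ N r := fun i => mem_compl.1 (a i).2
  have hpa : ∀ b i, p b (a i) ∈ N r := fun b i =>
    (hNa _ (ha i)).subset (hmem b (a i))
  have hinj : ∀ b, Function.Injective fun i => c.symm ⟨p b (a i), hpa b i⟩ := by
    intro b i j hij
    have h₁ : p b (a i) = p b (a j) := congrArg Subtype.val (c.symm.injective hij)
    have h₂ : (a i : ρ) = a j := by rw [← hinv b (a i), h₁, hinv]
    exact a.injective (Subtype.ext h₂)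
  let F : β → Equiv.Perm (Fin 3) := fun b =>
    Equiv.ofBijective _ (Finite.injective_iff_bijective.1 (hinj b))
  have hF : ∀ b i, p b (a i) = c (F b i) := fun b i => by simp [F]
  have hFinj : Function.Injective F := by
    intro b b' h
    refine hshare b b' (a 0) (a 1) (by rw [hF, hF, h]) (by rw [hF, hF, h]) (fun h => ?_)
      (fun h => ha 1 (h ▸ hpa b 0))
    exact absurd (a.injective (Subtype.ext h)) (by decide)
  have hcompl : (univ.image F)ᶜ.card = 1 := by
    rw [card_compl, card_image_of_injective _ hFinj, card_univ, hβ, Fintype.card_perm]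
    rfl
  obtain ⟨τ, hτ⟩ := card_eq_one.1 hcompl
  refine ⟨fun i => a i, fun j => c (τ j), Subtype.val_injective.comp a.injective,
    Subtype.val_injective.comp (c.injective.comp τ.injective),
    fun i j (h : (a i : ρ) = c (τ j)) => ha i (h ▸ (c (τ j)).2), fun σ hσ => ?_⟩
  have hne : τ * σ ∉ (univ.image F)ᶜ := by
    rw [hτ, mem_singleton]
    simpa using hσ
  obtain ⟨b, hb⟩ : ∃ b, F b = τ * σ := by simpa using hne
  exact ⟨b, fun i => by rw [hF, hb]; rfl⟩

theorem mem_affineSpan_pair_iff_area {u v : ℝ × ℝ} (huv : u ≠ v) (x : ℝ × ℝ) :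
    x ∈ (affineSpan ℝ ({u, v} : Set (ℝ × ℝ)) : Set (ℝ × ℝ)) ↔ area u v x = 0 := by
  rw [SetLike.mem_coe, mem_affineSpan_pair_iff_exists_lineMap_eq]
  constructor
  · rintro ⟨t, rfl⟩
    simp [area, AffineMap.lineMap_apply]
    ring
  · intro h
    unfold area at h
    by_cases h₁ : v.1 - u.1 = 0
    · have h₂ : v.2 - u.2 ≠ 0 := fun h₂ =>
        huv (Prod.ext (sub_eq_zero.1 h₁).symm (sub_eq_zero.1 h₂).symm)
      have hx : x.1 - u.1 = 0 := by
        rw [h₁] at h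
        simpa [h₂] using h
      refine ⟨(x.2 - u.2) / (v.2 - u.2), Prod.ext ?_ ?_⟩
      · simp [AffineMap.lineMap_apply, h₁]
        linarith
      · simp [AffineMap.lineMap_apply]
        field_simp
        ring
    · refine ⟨(x.1 - u.1) / (v.1 - u.1), Prod.ext ?_ ?_⟩
      · simp [AffineMap.lineMap_apply]
        field_simp
        ring
      · simp [AffineMap.lineMap_apply]
        field_simp
        linarith

theorem IsLine.mem_iff_area {L : Set (ℝ × ℝ)} (hL : IsLine L) {p q : ℝ × ℝ} (hpq : p ≠ q)
    (hp : p ∈ L) (hq : q ∈ L) (x : ℝ × ℝ) : x ∈ L ↔ area p q x = 0 := by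
  obtain ⟨u, v, huv, rfl⟩ := hL
  rw [mem_affineSpan_pair_iff_area huv]
  rw [SetLike.mem_coe, mem_affineSpan_pair_iff_exists_lineMap_eq] at hp hq
  obtain ⟨s, rfl⟩ := hp
  obtain ⟨t, rfl⟩ := hq
  have hst : t - s ≠ 0 := fun h => hpq (by rw [sub_eq_zero.1 h])
  have : area (AffineMap.lineMap u v s) (AffineMap.lineMap u v t) x = (t - s) * area u v x := by
    simp [area, AffineMap.lineMap_apply]
    ring
  rw [this]
  simp [hst]

theorem IsLine.eq_of_mem {L L' : Set (ℝ × ℝ)} (hL : IsLine L) (hL' : IsLine L') {p q : ℝ × ℝ}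
    (hpq : p ≠ q) (hp : p ∈ L) (hq : q ∈ L) (hp' : p ∈ L') (hq' : q ∈ L') : L = L' := by
  ext x
  rw [hL.mem_iff_area hpq hp hq, hL'.mem_iff_area hpq hp' hq']

theorem mem_ptsOn {P : Finset (ℝ × ℝ)} {L : Set (ℝ × ℝ)} {x : ℝ × ℝ} :
    x ∈ ptsOn P L ↔ x ∈ P ∧ x ∈ L := by
  simp [ptsOn]

open Finset in
/-- Six red and five blue points cannot be such that there are nine lines, each with exactly two
red and at most two blue points, which join every red point to every blue point. -/
theorem false_of_nine_lines {R B : Finset (ℝ × ℝ)} (hR : R.card = 6) (hB : B.card = 5)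
    (hRB : Disjoint R B) (S : Finset (Set (ℝ × ℝ))) (hS : S.card = 9)
    (hline : ∀ L ∈ S, IsLine L) (hred : ∀ L ∈ S, (ptsOn R L).card = 2)
    (hblue : ∀ L ∈ S, (ptsOn B L).card ≤ 2)
    (hjoin : ∀ r ∈ R, ∀ b ∈ B, ∃ L ∈ S, r ∈ L ∧ b ∈ L) : False := by
  have hne : ∀ {r b}, r ∈ R → b ∈ B → r ≠ b := fun hr hb h =>
    disjoint_left.1 hRB hr (h ▸ hb)
  have hthird : ∀ L ∈ S, ∀ {x y z}, x ∈ R → y ∈ R → z ∈ R → x ∈ L → y ∈ L → z ∈ L →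
      x ≠ y → z ≠ x → z = y := by
    intro L hL x y z hx hy hz hxL hyL hzL hxy hzx
    by_contra hzy
    have : ({x, y, z} : Finset (ℝ × ℝ)).card ≤ (ptsOn R L).card := card_le_card (by
      intro w hw
      simp only [mem_insert, mem_singleton] at hw
      rcases hw with rfl | rfl | rfl <;> exact mem_ptsOn.2 ⟨‹_›, ‹_›⟩)
    rw [hred L hL, card_eq_three.2 ⟨x, y, z, hxy, hzx.symm, Ne.symm hzy, rfl⟩] at this
    omega
  have hpartner : ∀ (b : B) (r : R), ∃ s : R, s ≠ r ∧
      ∃ L ∈ S, (r : ℝ × ℝ) ∈ L ∧ (s : ℝ × ℝ) ∈ L ∧ (b : ℝ × ℝ) ∈ L := by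
    intro b r
    obtain ⟨L, hL, hr, hb⟩ := hjoin r r.2 b b.2
    obtain ⟨s, hs, hsr⟩ := exists_mem_ne (by rw [hred L hL]; norm_num) (r : ℝ × ℝ)
    exact ⟨⟨s, (mem_ptsOn.1 hs).1⟩, fun h => hsr (congrArg Subtype.val h), L, hL, hr,
      (mem_ptsOn.1 hs).2, hb⟩
  choose p hpne hpline using hpartner
  have huniq : ∀ (b : B) (r s : R), s ≠ r → ∀ L ∈ S, (r : ℝ × ℝ) ∈ L → (s : ℝ × ℝ) ∈ L →
      (b : ℝ × ℝ) ∈ L → p b r = s := by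
    intro b r s hsr L hL hr hs hb
    obtain ⟨L', hL', hr', hp', hb'⟩ := hpline b r
    obtain rfl := (hline L hL).eq_of_mem (hline L' hL') (hne r.2 b.2) hr hb hr' hb'
    exact Subtype.ext (hthird L hL r.2 s.2 (p b r).2 hr hs hp'
      (fun h => hsr (Subtype.ext h.symm)) (fun h => hpne b r (Subtype.ext h)))
  refine absurd (exists_bipartition (ρ := R) (β := B) (by simpa using hR)
    (by simpa using hB) p ?_ hpne ?_ ?_ ?_) ?_
  · intro b r
    obtain ⟨L, hL, h₁, h₂, h₃⟩ := hpline b r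
    exact huniq b _ _ (hpne b r).symm L hL h₂ h₁ h₃
  · intro r s
    obtain hempty | ⟨b, hb⟩ := (univ.filter fun b => p b r = s).eq_empty_or_nonempty
    · rw [hempty, card_empty]
      exact zero_le
    obtain rfl : p b r = s := by simpa using hb
    obtain ⟨L, hL, h₁, h₂, h₃⟩ := hpline b r
    rw [← card_map (Function.Embedding.subtype _)]
    refine (card_le_card fun x hx => ?_).trans (hblue L hL)
    obtain ⟨b', hb', rfl⟩ := mem_map.1 hx
    have hb' : p b' r = p b r := by simpa using hb'
    obtain ⟨L', hL', h₁', h₂', h₃'⟩ := hpline b' r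
    rw [hb'] at h₂'
    obtain rfl := (hline L hL).eq_of_mem (hline L' hL')
      (fun h => hpne b r (Subtype.ext h)) h₂ h₁ h₂' h₁'
    exact mem_ptsOn.2 ⟨b'.2, h₃'⟩
  · intro b b' r s hr hs hsr hsp
    by_contra hbb
    have hjoined : ∀ t, p b t = p b' t → ∃ L ∈ S, (t : ℝ × ℝ) ∈ L ∧ (p b t : ℝ × ℝ) ∈ L ∧
        (b : ℝ × ℝ) ∈ L ∧ (b' : ℝ × ℝ) ∈ L := by
      intro t ht
      obtain ⟨L, hL, h₁, h₂, h₃⟩ := hpline b t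
      obtain ⟨L', hL', h₁', h₂', h₃'⟩ := hpline b' t
      rw [← ht] at h₂'
      obtain rfl := (hline L hL).eq_of_mem (hline L' hL')
        (fun h => hpne b t (Subtype.ext h)) h₂ h₁ h₂' h₁'
      exact ⟨L, hL, h₁, h₂, h₃, h₃'⟩
    obtain ⟨L, hL, h₁, h₂, h₃, h₄⟩ := hjoined r hr
    obtain ⟨L', hL', h₁', -, h₃', h₄'⟩ := hjoined s hs
    obtain rfl := (hline L hL).eq_of_mem (hline L' hL')
      (fun h => hbb (Subtype.ext h)) h₃ h₄ h₃' h₄'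
    exact hsp (huniq b r s hsr L hL h₁ h₁' h₃).symm
  · rw [← card_map ((Function.Embedding.subtype _).prodMap (Function.Embedding.subtype _))]
    refine (card_le_card (t := S.biUnion fun L => (ptsOn R L).offDiag) fun x hx => ?_).trans
      ((card_biUnion_le_card_mul S _ 2 fun L hL => ?_).trans_eq (by rw [hS]))
    · obtain ⟨⟨r, s⟩, he, rfl⟩ := mem_map.1 hx
      obtain ⟨b, rfl⟩ : ∃ b, p b r = s := (mem_filter.1 he).2
      obtain ⟨L, hL, h₁, h₂, -⟩ := hpline b r
      exact mem_biUnion.2 ⟨L, hL, mem_offDiag.2 ⟨mem_ptsOn.2 ⟨r.2, h₁⟩,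
        mem_ptsOn.2 ⟨(p b r).2, h₂⟩, fun h => hpne b r (Subtype.ext h.symm)⟩⟩
    · rw [offDiag_card, hred L hL]
  · rintro ⟨a, c, ha, hc, hac, h⟩
    have hreach : ∀ i k, ∃ L ∈ S, (a i : ℝ × ℝ) ∈ L ∧ (c k : ℝ × ℝ) ∈ L := by
      intro i k
      obtain ⟨σ, hσ, hik⟩ : ∃ σ : Equiv.Perm (Fin 3), σ ≠ 1 ∧ σ i = k := by
        revert i k; decide
      obtain ⟨b, hb⟩ := h σ hσ
      obtain ⟨L, hL, h₁, h₂, -⟩ := hpline b (a i)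
      have hck : p b (a i) = c k := by rw [hb, hik]
      exact ⟨L, hL, h₁, hck ▸ h₂⟩
    have hoff : ∀ {x y z : R}, x ≠ y → x ≠ z → y ≠ z →
        (∃ L ∈ S, (x : ℝ × ℝ) ∈ L ∧ (z : ℝ × ℝ) ∈ L) → area x y z ≠ 0 := by
      rintro x y z hxy hxz hyz ⟨L, hL, hx, hz⟩ h0
      have hzx' : (z : ℝ × ℝ) ≠ x := fun h => hxz (Subtype.ext h.symm)
      have hy : (y : ℝ × ℝ) ∈ L := ((hline L hL).mem_iff_area hzx' hz hx y).2
        (by rw [area_rotate (y : ℝ × ℝ), ← area_rotate, ← area_rotate, h0])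
      exact hyz (Subtype.ext (hthird L hL x.2 z.2 y.2 hx hz hy hzx'.symm
        (fun h => hxy (Subtype.ext h.symm))))
    refine false_of_perspective (a := fun i => a i) (c := fun k => c k)
      (fun i j k hij => hoff (ha.ne hij) (hac i k) (hac j k) (hreach i k))
      (fun i j k hij => hoff (hc.ne hij) (hac k i).symm (hac k j).symm ?_) fun σ hσ => ?_
    · obtain ⟨L, hL, h₁, h₂⟩ := hreach k i
      exact ⟨L, hL, h₂, h₁⟩
    · obtain ⟨b, hb⟩ := h σ hσ
      refine ⟨b, fun i => ?_⟩
      obtain ⟨L, hL, h₁, h₂, h₃⟩ := hpline b (a i)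
      rw [hb] at h₂
      exact ((hline L hL).mem_iff_area (hne (a i).2 b.2).symm h₃ h₁ _).1 h₂

/-- **Proposition 4.6.** It is not possible to arrange 6 red and 5 blue points in
the plane so that exactly 6 lines contain exactly 2 red and 2 blue points
(`s₂,₂ = 6`) and exactly 3 lines contain exactly 2 red and 1 blue point
(`s₂,₁ = 3`). -/
theorem no_six_five_configuration :
    ¬ ∃ (R B : Finset (ℝ × ℝ)), R.card = 6 ∧ B.card = 5 ∧ Disjoint R B ∧
      {L : Set (ℝ × ℝ) | IsLine L ∧ (ptsOn R L).card = 2 ∧ (ptsOn B L).card = 2}.ncard = 6 ∧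
      {L : Set (ℝ × ℝ) | IsLine L ∧ (ptsOn R L).card = 2 ∧ (ptsOn B L).card = 1}.ncard = 3 := by
  rintro ⟨R, B, hR, hB, hRB, h₂₂, h₂₁⟩
  obtain ⟨S, hS⟩ := (Set.finite_of_ncard_ne_zero (by rw [h₂₂]; norm_num)).exists_finset_coe
  obtain ⟨T, hT⟩ := (Set.finite_of_ncard_ne_zero (by rw [h₂₁]; norm_num)).exists_finset_coe
  rw [← hS, Set.ncard_coe_finset] at h₂₂
  rw [← hT, Set.ncard_coe_finset] at h₂₁
  have hS' : ∀ L, L ∈ S ↔ IsLine L ∧ (ptsOn R L).card = 2 ∧ (ptsOn B L).card = 2 := fun L =>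
    Set.ext_iff.1 hS L
  have hT' : ∀ L, L ∈ T ↔ IsLine L ∧ (ptsOn R L).card = 2 ∧ (ptsOn B L).card = 1 := fun L =>
    Set.ext_iff.1 hT L
  have hdisj : Disjoint S T := Finset.disjoint_left.2 fun L h h' => by
    have h₁ := ((hS' L).1 h).2.2
    have h₂ := ((hT' L).1 h').2.2
    omega
  have hline : ∀ L ∈ S ∪ T, IsLine L := fun L hL =>
    (Finset.mem_union.1 hL).elim (fun h => ((hS' L).1 h).1) fun h => ((hT' L).1 h).1
  -- The lines in `S` and `T` join `6 * 4 + 3 * 2 = 30` red-blue pairs, that is, all of them.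
  have hcard : ((S ∪ T).biUnion fun L => ptsOn R L ×ˢ ptsOn B L).card = 30 := by
    have hS₄ : ∀ L ∈ S, (ptsOn R L ×ˢ ptsOn B L).card = 4 := fun L hL => by
      rw [Finset.card_product, ((hS' L).1 hL).2.1, ((hS' L).1 hL).2.2]
    have hT₂ : ∀ L ∈ T, (ptsOn R L ×ˢ ptsOn B L).card = 2 := fun L hL => by
      rw [Finset.card_product, ((hT' L).1 hL).2.1, ((hT' L).1 hL).2.2]
    rw [Finset.card_biUnion, Finset.sum_union hdisj, Finset.sum_congr rfl hS₄,
      Finset.sum_congr rfl hT₂]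
    · simp [h₂₂, h₂₁]
    · intro L hL L' hL' hne
      refine Finset.disjoint_left.2 fun x hx hx' => hne ?_
      simp only [Finset.mem_product, mem_ptsOn] at hx hx'
      exact (hline L hL).eq_of_mem (hline L' hL')
        (fun h => Finset.disjoint_left.1 hRB hx.1.1 (by rw [h]; exact hx.2.1)) hx.1.2 hx.2.2 hx'.1.2 hx'.2.2
  have hall : ((S ∪ T).biUnion fun L => ptsOn R L ×ˢ ptsOn B L) = R ×ˢ B := by
    refine Finset.eq_of_subset_of_card_le (Finset.biUnion_subset.2 fun L _ =>
      Finset.product_subset_product (Finset.filter_subset _ _) (Finset.filter_subset _ _)) ?_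
    rw [hcard, Finset.card_product, hR, hB]
  refine false_of_nine_lines hR hB hRB (S ∪ T)
    (by rw [Finset.card_union_of_disjoint hdisj, h₂₂, h₂₁]) hline ?_ ?_ ?_
  · exact fun L hL =>
      (Finset.mem_union.1 hL).elim (fun h => ((hS' L).1 h).2.1) fun h => ((hT' L).1 h).2.1
  · exact fun L hL =>
      (Finset.mem_union.1 hL).elim (fun h => ((hS' L).1 h).2.2.le)
        fun h => ((hT' L).1 h).2.2.le.trans one_le_two
  · intro r hr b hb
    have : (r, b) ∈ (S ∪ T).biUnion fun L => ptsOn R L ×ˢ ptsOn B L := by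
      rw [hall]
      exact Finset.mem_product.2 ⟨hr, hb⟩
    obtain ⟨L, hL, hx⟩ := Finset.mem_biUnion.1 this
    obtain ⟨h₁, h₂⟩ := Finset.mem_product.1 hx
    exact ⟨L, hL, (mem_ptsOn.1 h₁).2, (mem_ptsOn.1 h₂).2⟩
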